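/- arXiv:math/0504114 — 2 statements merged into one kernel-verified Lean document; each statement's English description precedes it below -/
import Mathlib

section
/- Let λ, ξ ∈ ℂ \ {0} and suppose that λ ∉ {1,-1} or ξ ∉ {1,-1}. Let A = diag(λ, λ⁻¹) and B = diag(ξ, ξ⁻¹) in SL₂(ℂ), and let sl₂(ℂ) be the space of traceless 2×2 complex matrices. Then the complex vector space Z¹ = { (X,Y) ∈ sl₂(ℂ) × sl₂(ℂ) : X + A Y A⁻¹ = Y + B X B⁻¹ } has complex dimension 4. -/
/-- A vector of the plane proportional to a nonzero vector is a multiple of it. -/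
theorem exists_eq_mul_of_mul_eq_mul {K : Type*} [Field K] {s t x y : K} (h : s ≠ 0 ∨ t ≠ 0)
    (hxy : t * x = s * y) : ∃ k, x = k * s ∧ y = k * t := by
  rcases h with h | h
  · refine ⟨x / s, by field_simp, ?_⟩
    field_simp
    linear_combination -hxy
  · refine ⟨y / t, ?_, by field_simp⟩
    field_simp
    linear_combination hxy

theorem one_sub_sq_ne_zero {K : Type*} [Field K] {x : K} (h : x ∉ ({1, -1} : Set K)) :
    1 - x ^ 2 ≠ 0 := fun hx =>
  h (by simpa using (show x ^ 2 = 1 by linear_combination -hx))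

theorem conj_diag_fin_two {K : Type*} [Field K] {x : K} (hx : x ≠ 0)
    (M : Matrix (Fin 2) (Fin 2) K) :
    !![x, 0; 0, x⁻¹] * M * !![x, 0; 0, x⁻¹]⁻¹ =
      !![M 0 0, x ^ 2 * M 0 1; x⁻¹ ^ 2 * M 1 0, M 1 1] := by
  have hinv : !![x, 0; 0, x⁻¹]⁻¹ = !![x⁻¹, 0; 0, x] := by
    apply Matrix.inv_eq_right_inv
    ext i j
    fin_cases i <;> fin_cases j <;> simp [hx]
  rw [hinv]
  ext i j
  fin_cases i <;> fin_cases j <;>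
    simp [Matrix.mul_apply, Matrix.vecMul, dotProduct, Fin.sum_univ_two] <;> field_simp

/-- Let `λ, ξ ∈ ℂ*` with `λ ∉ {1,-1}` or `ξ ∉ {1,-1}`, and
`A = diag(λ,λ⁻¹)`, `B = diag(ξ,ξ⁻¹)`. The space
`Z¹ = {(X,Y) ∈ sl₂(ℂ)² : X + A Y A⁻¹ = Y + B X B⁻¹}` of group `1`-cocycles has complex
dimension `4`: it is the span of `4` linearly independent vectors. -/
theorem stmt_15 (lam ξ : ℂ) (hlam : lam ≠ 0) (hξ : ξ ≠ 0)
    (h : lam ∉ ({1, -1} : Set ℂ) ∨ ξ ∉ ({1, -1} : Set ℂ))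
    (A B : Matrix (Fin 2) (Fin 2) ℂ)
    (hA : A = !![lam, 0; 0, lam⁻¹]) (hB : B = !![ξ, 0; 0, ξ⁻¹]) :
    ∃ v : Fin 4 → Matrix (Fin 2) (Fin 2) ℂ × Matrix (Fin 2) (Fin 2) ℂ,
      LinearIndependent ℂ v ∧
      (Submodule.span ℂ (Set.range v) :
          Set (Matrix (Fin 2) (Fin 2) ℂ × Matrix (Fin 2) (Fin 2) ℂ)) =
        {p : Matrix (Fin 2) (Fin 2) ℂ × Matrix (Fin 2) (Fin 2) ℂ |
          Matrix.trace p.1 = 0 ∧ Matrix.trace p.2 = 0 ∧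
          p.1 + A * p.2 * A⁻¹ = p.2 + B * p.1 * B⁻¹} := by
  have hu : lam⁻¹ ∉ ({1, -1} : Set ℂ) ∨ ξ⁻¹ ∉ ({1, -1} : Set ℂ) := by
    simpa [inv_eq_iff_eq_inv, inv_neg] using h
  have h₁ := h.imp one_sub_sq_ne_zero one_sub_sq_ne_zero
  have h₂ := hu.imp one_sub_sq_ne_zero one_sub_sq_ne_zero
  subst hA hB
  simp only [conj_diag_fin_two hlam, conj_diag_fin_two hξ]
  refine ⟨![(!![1, 0; 0, -1], 0), (0, !![1, 0; 0, -1]),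
    (!![0, 1 - lam ^ 2; 0, 0], !![0, 1 - ξ ^ 2; 0, 0]),
    (!![0, 0; 1 - lam⁻¹ ^ 2, 0], !![0, 0; 1 - ξ⁻¹ ^ 2, 0])], ?_, ?_⟩
  · rw [Fintype.linearIndependent_iff]
    intro g hg
    simp only [Fin.sum_univ_four, Prod.ext_iff, ← Matrix.ext_iff, Fin.forall_fin_two] at hg
    simp [-inv_pow] at hg
    obtain ⟨⟨⟨h00, h01⟩, h10, -⟩, ⟨k00, k01⟩, k10, -⟩ := hg
    intro i
    fin_cases i
    · exact h00
    · exact k00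
    · rcases h₁ with h₁ | h₁
      · exact h01.resolve_right h₁
      · exact k01.resolve_right h₁
    · rcases h₂ with h₂ | h₂
      · exact h10.resolve_right h₂
      · exact k10.resolve_right h₂
  · ext ⟨X, Y⟩
    rw [SetLike.mem_coe, Submodule.mem_span_range_iff_exists_fun]
    simp only [Fin.sum_univ_four, Set.mem_ofPred_eq, Prod.ext_iff, ← Matrix.ext_iff,
      Fin.forall_fin_two, Matrix.trace_fin_two]
    simp [-inv_pow]
    constructor
    · rintro ⟨g, ⟨⟨h00, h01⟩, h10, h11⟩, ⟨k00, k01⟩, k10, k11⟩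
      simp only [← h00, ← h01, ← h10, ← h11, ← k00, ← k01, ← k10, ← k11]
      refine ⟨?_, ?_, ⟨?_, ?_⟩, ?_, ?_⟩ <;> ring
    · rintro ⟨hX, hY, ⟨-, e01⟩, e10, -⟩
      obtain ⟨k, hk, hk'⟩ := exists_eq_mul_of_mul_eq_mul (x := X 0 1) (y := Y 0 1) h₁
        (by linear_combination e01)
      obtain ⟨l, hl, hl'⟩ := exists_eq_mul_of_mul_eq_mul (x := X 1 0) (y := Y 1 0) h₂
        (by linear_combination e10)
      refine ⟨![X 0 0, Y 0 0, k, l], ?_⟩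
      simp [-inv_pow, hk, hk', hl, hl']
      exact ⟨by linear_combination -hX, by linear_combination -hY⟩
end

section
/- Let λ, ξ ∈ ℂ \ {0} and suppose that λ ∉ {1,-1} or ξ ∉ {1,-1}. Let A = diag(λ, λ⁻¹) and B = diag(ξ, ξ⁻¹) in SL₂(ℂ), and let sl₂(ℂ) be the space of traceless 2×2 complex matrices. Let Z¹ = { (X,Y) ∈ sl₂(ℂ)² : X + A Y A⁻¹ = Y + B X B⁻¹ } and B¹ = { (v - A v A⁻¹, v - B v B⁻¹) : v ∈ sl₂(ℂ) }. Then B¹ ⊆ Z¹ and the quotient vector space Z¹/B¹ has complex dimension 2. -/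
theorem diag_conj_fin_two {a : ℂ} (ha : a ≠ 0) (M : Matrix (Fin 2) (Fin 2) ℂ) :
    !![a, 0; 0, a⁻¹] * M * (!![a, 0; 0, a⁻¹])⁻¹ =
      !![M 0 0, a ^ 2 * M 0 1; (a ^ 2)⁻¹ * M 1 0, M 1 1] := by
  have hinv : (!![a, 0; 0, a⁻¹] : Matrix (Fin 2) (Fin 2) ℂ)⁻¹ = !![a⁻¹, 0; 0, a] := by
    apply Matrix.inv_eq_right_inv
    ext i j
    fin_cases i <;> fin_cases j <;> simp [Matrix.mul_apply, ha]
  rw [hinv, Matrix.eta_fin_two M]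
  ext i j
  fin_cases i <;> fin_cases j <;> simp <;> field_simp

theorem exists_sub_mul_eq {a b x y : ℂ} (hab : a ≠ 1 ∨ b ≠ 1) (h : x + a * y = y + b * x) :
    ∃ w, x = w - a * w ∧ y = w - b * w := by
  rcases hab with ha | hb
  · have h1 : 1 - a ≠ 0 := sub_ne_zero.2 ha.symm
    refine ⟨x / (1 - a), ?_, ?_⟩
    · field_simp
    · field_simp
      linear_combination -h
  · have h1 : 1 - b ≠ 0 := sub_ne_zero.2 hb.symm
    refine ⟨y / (1 - b), ?_, ?_⟩
    · field_simp
      linear_combination h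
    · field_simp

/-- With `A = diag(λ,λ⁻¹)`, `B = diag(ξ,ξ⁻¹)` (`λ,ξ ≠ 0`, and `λ ∉ {1,-1}`
or `ξ ∉ {1,-1}`), let
`Z¹ = {(X,Y) ∈ sl₂(ℂ)² : X + A Y A⁻¹ = Y + B X B⁻¹}` and
`B¹ = {(v - A v A⁻¹, v - B v B⁻¹) : v ∈ sl₂(ℂ)}`. Then `B¹ ⊆ Z¹` and the quotient
`Z¹/B¹` has complex dimension `2`: there are two cocycles `v 0, v 1 ∈ Z¹` such that every
element of `Z¹` is congruent mod `B¹` to a unique linear combination of them. -/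
theorem stmt_16 (lam ξ : ℂ) (hlam : lam ≠ 0) (hξ : ξ ≠ 0)
    (h : lam ∉ ({1, -1} : Set ℂ) ∨ ξ ∉ ({1, -1} : Set ℂ))
    (A B : Matrix (Fin 2) (Fin 2) ℂ)
    (hA : A = !![lam, 0; 0, lam⁻¹]) (hB : B = !![ξ, 0; 0, ξ⁻¹]) :
    ({p : Matrix (Fin 2) (Fin 2) ℂ × Matrix (Fin 2) (Fin 2) ℂ |
        ∃ w : Matrix (Fin 2) (Fin 2) ℂ, Matrix.trace w = 0 ∧
          p = (w - A * w * A⁻¹, w - B * w * B⁻¹)} ⊆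
      {p : Matrix (Fin 2) (Fin 2) ℂ × Matrix (Fin 2) (Fin 2) ℂ |
        Matrix.trace p.1 = 0 ∧ Matrix.trace p.2 = 0 ∧
        p.1 + A * p.2 * A⁻¹ = p.2 + B * p.1 * B⁻¹}) ∧
    ∃ v : Fin 2 → Matrix (Fin 2) (Fin 2) ℂ × Matrix (Fin 2) (Fin 2) ℂ,
      (∀ i, v i ∈ {p : Matrix (Fin 2) (Fin 2) ℂ × Matrix (Fin 2) (Fin 2) ℂ |
          Matrix.trace p.1 = 0 ∧ Matrix.trace p.2 = 0 ∧
          p.1 + A * p.2 * A⁻¹ = p.2 + B * p.1 * B⁻¹}) ∧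
      (∀ z ∈ {p : Matrix (Fin 2) (Fin 2) ℂ × Matrix (Fin 2) (Fin 2) ℂ |
          Matrix.trace p.1 = 0 ∧ Matrix.trace p.2 = 0 ∧
          p.1 + A * p.2 * A⁻¹ = p.2 + B * p.1 * B⁻¹},
        ∃ c : Fin 2 → ℂ,
          z - (c 0 • v 0 + c 1 • v 1) ∈
            {p : Matrix (Fin 2) (Fin 2) ℂ × Matrix (Fin 2) (Fin 2) ℂ |
              ∃ w : Matrix (Fin 2) (Fin 2) ℂ, Matrix.trace w = 0 ∧
                p = (w - A * w * A⁻¹, w - B * w * B⁻¹)}) ∧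
      (∀ c : Fin 2 → ℂ,
        (c 0 • v 0 + c 1 • v 1) ∈
            {p : Matrix (Fin 2) (Fin 2) ℂ × Matrix (Fin 2) (Fin 2) ℂ |
              ∃ w : Matrix (Fin 2) (Fin 2) ℂ, Matrix.trace w = 0 ∧
                p = (w - A * w * A⁻¹, w - B * w * B⁻¹)} → c = 0) := by
  subst hA hB
  have hab : lam ^ 2 ≠ 1 ∨ ξ ^ 2 ≠ 1 := by
    simpa only [Set.mem_insert_iff, Set.mem_singleton_iff, ne_eq,
      ← mul_self_eq_one_iff, ← pow_two] using h
  simp only [diag_conj_fin_two hlam, diag_conj_fin_two hξ, Set.mem_ofPred_eq]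
  refine ⟨?_, ![(!![1, 0; 0, -1], 0), (0, !![1, 0; 0, -1])], ?_, ?_, ?_⟩
  · rintro _ ⟨w, hw, rfl⟩
    rw [Matrix.trace_fin_two] at hw
    refine ⟨?_, ?_, ?_⟩
    · simp [Matrix.trace_fin_two]
    · simp [Matrix.trace_fin_two]
    · ext i j
      fin_cases i <;> fin_cases j <;> simp <;> ring
  · intro i
    fin_cases i <;> simp [Matrix.trace_fin_two]
  · rintro ⟨X, Y⟩ ⟨hX, hY, hXY⟩
    rw [Matrix.trace_fin_two] at hX hY
    simp only [← Matrix.ext_iff, Fin.forall_fin_two] at hXY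
    simp at hXY hX hY
    obtain ⟨⟨-, h01⟩, h10, -⟩ := hXY
    obtain ⟨u, hu1, hu2⟩ := exists_sub_mul_eq hab h01
    obtain ⟨t, ht1, ht2⟩ := exists_sub_mul_eq
      (a := (lam ^ 2)⁻¹) (b := (ξ ^ 2)⁻¹) (by simpa only [ne_eq, inv_eq_one] using hab) h10
    refine ⟨![X 0 0, Y 0 0], !![0, u; t, 0], by simp [Matrix.trace_fin_two], ?_⟩
    refine Prod.ext ?_ ?_
    · ext i j
      fin_cases i <;> fin_cases j <;> simp
      · exact hu1
      · exact ht1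
      · linear_combination hX
    · ext i j
      fin_cases i <;> fin_cases j <;> simp
      · exact hu2
      · exact ht2
      · linear_combination hY
  · rintro c ⟨w, -, hw⟩
    have h0 := congrArg (fun p => p.1 0 0) hw
    have h1 := congrArg (fun p => p.2 0 0) hw
    simp at h0 h1
    ext i
    fin_cases i
    · exact h0
    · exact h1
end
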